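/- The Jacobian of the event-horizon system at P₁ = (0,0,0) has eigenvalues 2, 2, and 3β - 3γ + 1. Hence P₁ is an unstable source whenever γ < β + 1/3. -/

import Mathlib

/-- Vector field of the Model 2 autonomous system with future event horizon IR cutoff. -/
noncomputable def Gev (α β γ b : ℝ) (p : ℝ × ℝ × ℝ) : ℝ × ℝ × ℝ :=
  let x := p.1; let y := p.2.1; let z := p.2.2
  (x * ((1 + 3 * β - 3 * γ + 3 * α * z / (1 - z)) * (1 - x)
        - 2 * y * (1 + Real.sqrt y / b)),
   y * (2 * (1 - y) * (1 + Real.sqrt y / b)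
        - x * (1 + 3 * β - 3 * γ + 3 * α * z / (1 - z))),
   z * (1 - z) / 2 *
     (4 - 2 * y * (1 + Real.sqrt y / b)
        - x * (1 + 3 * β - 3 * γ + 3 * α * z / (1 - z))))

/-- Jacobian matrix of `Gev` at a point, via Fréchet derivatives. -/
noncomputable def Jev (α β γ b : ℝ) (p : ℝ × ℝ × ℝ) : Matrix (Fin 3) (Fin 3) ℝ :=
  let e : Fin 3 → ℝ × ℝ × ℝ := ![(1, 0, 0), (0, 1, 0), (0, 0, 1)]
  Matrix.of fun i j =>
    fderiv ℝ (fun q => ![(Gev α β γ b q).1, (Gev α β γ b q).2.1,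
      (Gev α β γ b q).2.2] i) p (e j)

theorem hasFDerivAt_mul_cont (L : ℝ × ℝ × ℝ →L[ℝ] ℝ) (h : ℝ × ℝ × ℝ → ℝ)
    (hh : ContinuousAt h 0) : HasFDerivAt (fun q => L q * h q) (h 0 • L) 0 := by
  rw [hasFDerivAt_iff_isLittleO_nhds_zero]
  have h1 : (fun q : ℝ × ℝ × ℝ => h q - h 0) =o[nhds 0] (fun _ => (1 : ℝ)) := by
    rw [Asymptotics.isLittleO_one_iff]
    have := hh.tendsto.sub_const (h 0)
    simpa using this
  have h2 : (fun q : ℝ × ℝ × ℝ => L q) =O[nhds 0] (fun q => q) := L.isBigO_id _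
  have h3 := h2.norm_right.mul_isLittleO h1
  have h4 : (fun q : ℝ × ℝ × ℝ => L q * (h q - h 0)) =o[nhds 0] (fun q => q) := by
    rw [← Asymptotics.isLittleO_norm_right]
    simpa using h3
  refine h4.congr_left fun q => ?_
  simp
  ring

theorem Jev_zero (α β γ b : ℝ) :
    Jev α β γ b (0, 0, 0) = Matrix.diagonal ![3 * β - 3 * γ + 1, 2, 2] := by
  have hz : ContinuousAt (fun q : ℝ × ℝ × ℝ => 3 * α * q.2.2 / (1 - q.2.2)) 0 := by
    apply ContinuousAt.div
    · fun_prop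
    · fun_prop
    · simp
  have e1 := hasFDerivAt_mul_cont (ContinuousLinearMap.fst ℝ ℝ (ℝ × ℝ))
    (fun q => (1 + 3 * β - 3 * γ + 3 * α * q.2.2 / (1 - q.2.2)) * (1 - q.1)
        - 2 * q.2.1 * (1 + Real.sqrt q.2.1 / b)) (by fun_prop)
  have e2 := hasFDerivAt_mul_cont
    ((ContinuousLinearMap.fst ℝ ℝ ℝ).comp (ContinuousLinearMap.snd ℝ ℝ (ℝ × ℝ)))
    (fun q => 2 * (1 - q.2.1) * (1 + Real.sqrt q.2.1 / b)
        - q.1 * (1 + 3 * β - 3 * γ + 3 * α * q.2.2 / (1 - q.2.2))) (by fun_prop)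
  have e3 := hasFDerivAt_mul_cont
    ((ContinuousLinearMap.snd ℝ ℝ ℝ).comp (ContinuousLinearMap.snd ℝ ℝ (ℝ × ℝ)))
    (fun q => (1 - q.2.2) / 2 * (4 - 2 * q.2.1 * (1 + Real.sqrt q.2.1 / b)
        - q.1 * (1 + 3 * β - 3 * γ + 3 * α * q.2.2 / (1 - q.2.2)))) (by fun_prop)
  have f1 : fderiv ℝ (fun q => (Gev α β γ b q).1) (0, 0, 0) = _ := e1.fderiv
  have f2 : fderiv ℝ (fun q => (Gev α β γ b q).2.1) (0, 0, 0) = _ := e2.fderiv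
  have g3 : (fun q => (Gev α β γ b q).2.2) = _ := funext fun q =>
    show _ = q.2.2 * ((1 - q.2.2) / 2 * (4 - 2 * q.2.1 * (1 + Real.sqrt q.2.1 / b)
        - q.1 * (1 + 3 * β - 3 * γ + 3 * α * q.2.2 / (1 - q.2.2)))) by
      simp only [Gev]
      ring
  have f3 := e3.fderiv
  change fderiv ℝ (fun q => q.2.2 * _) (0, 0, 0) = _ at f3
  rw [← g3] at f3
  ext i j
  fin_cases i <;> fin_cases j <;> simp [Jev, f1, f2, f3] <;> ring

theorem P1_jacobian_eigenvalues (α β γ b : ℝ) (hb : 0 < b) :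
    ((Jev α β γ b (0, 0, 0)
        - (2 : ℝ) • (1 : Matrix (Fin 3) (Fin 3) ℝ)).det = 0 ∧
     (Jev α β γ b (0, 0, 0)
        - (3 * β - 3 * γ + 1) • (1 : Matrix (Fin 3) (Fin 3) ℝ)).det = 0 ∧
     (Matrix.charpoly (Jev α β γ b (0, 0, 0))).roots =
       {2, 2, 3 * β - 3 * γ + 1}) ∧
    (γ < β + 1 / 3 → 0 < (2 : ℝ) ∧ 0 < 3 * β - 3 * γ + 1) := by
  rw [Jev_zero]
  refine ⟨⟨?_, ?_, ?_⟩, fun h => ⟨by norm_num, by linarith⟩⟩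
  · simp [Matrix.det_fin_three]
  · simp [Matrix.det_fin_three]
  · have : (Matrix.diagonal ![3 * β - 3 * γ + 1, 2, 2]).charpoly =
        (({2, 2, 3 * β - 3 * γ + 1} : Multiset ℝ).map
          (fun a => Polynomial.X - Polynomial.C a)).prod := by
      rw [Matrix.charpoly_diagonal, Fin.prod_univ_three]
      simp
      ring
    rw [this, Polynomial.roots_multiset_prod_X_sub_C]
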